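/- Assume p̄ = 1/2. There is a constant A > 0 such that for every initial distribution η of the environment Markov chain and all n ≥ 1, E_η[(Σ_{i=1}^n (G̃_i − 1))⁴] ≤ A n². -/

import Mathlib

open MeasureTheory Filter Set Matrix ProbabilityTheory
open scoped Classical

noncomputable section

/-- `K` is a (row-)stochastic matrix. -/
def IsStochastic {n : Type*} [Fintype n] (K : Matrix n n ℝ) : Prop :=
  (∀ i j, 0 ≤ K i j) ∧ ∀ i, ∑ j, K i j = 1

/-- `v` is a probability (row) vector. -/
def IsProbVec {n : Type*} [Fintype n] (v : n → ℝ) : Prop :=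
  (∀ i, 0 ≤ v i) ∧ ∑ i, v i = 1

/-- `μ` is a stationary distribution for `K`, i.e. `μ K = μ`. -/
def IsStationaryDist {n : Type*} [Fintype n] (K : Matrix n n ℝ) (μ : n → ℝ) : Prop :=
  IsProbVec μ ∧ Matrix.vecMul μ K = μ

/-- `μ` is the unique stationary distribution of `K` (equivalent, for a finite chain, to `K`
having a unique closed irreducible subset). -/
def HasUniqueStationaryDist {n : Type*} [Fintype n] (K : Matrix n n ℝ) (μ : n → ℝ) : Prop :=
  IsStationaryDist K μ ∧ ∀ μ' : n → ℝ, IsStationaryDist K μ' → μ' = μ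

/-- `(Pm, Rc, ξ)` is the (averaged) law of the environment and coin tosses at a single site:
`Rc` is a Markov chain with transition matrix `K` and initial distribution `η`
(0-based indexing: `Rc j` is `R_{j+1}` of the paper) and, conditionally on the chain, the
`ξ j` are independent Bernoulli with success probability `p (Rc j)`. -/
def IsCookieSite {N : ℕ} {Ω : Type*} [MeasurableSpace Ω] (Pm : Measure Ω)
    (K : Matrix (Fin N) (Fin N) ℝ) (p η : Fin N → ℝ)
    (Rc : ℕ → Ω → Fin N) (ξ : ℕ → Ω → Bool) : Prop :=
  (∀ j, Measurable (Rc j)) ∧ (∀ j, Measurable (ξ j)) ∧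
    ∀ (m : ℕ) (f : ℕ → Fin N) (b : ℕ → Bool),
      (Pm {ω | ∀ j ≤ m, Rc j ω = f j ∧ ξ j ω = b j}).toReal =
        η (f 0) * (∏ j ∈ Finset.range m, K (f j) (f (j + 1))) *
          ∏ j ∈ Finset.range (m + 1), (if b j then p (f j) else 1 - p (f j))

/-- `numSucc ξx m` = number of successes before the `m`-th failure in the Bernoulli
sequence `ξx` (the quantity `S_m` of the paper). -/
def numSucc (ξx : ℕ → Bool) (m : ℕ) : ℕ :=
  sInf {k | ((Finset.range (k + m)).filter fun j => ξx j = false).card = m}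

/-- `numFail ξx m` = number of failures before the `m`-th success in the Bernoulli
sequence `ξx` (the quantity `F_m` of the paper). -/
def numFail (ξx : ℕ → Bool) (m : ℕ) : ℕ :=
  sInf {k | ((Finset.range (k + m)).filter fun j => ξx j = true).card = m}

/-- The forward branching-like process: `U_0 = y`, `U_i = S^i_{U_{i−1}}`. -/
def Uproc (ξ : ℤ → ℕ → Bool) (y : ℕ) : ℕ → ℕ
  | 0 => y
  | i + 1 => numSucc (ξ ((i : ℤ) + 1)) (Uproc ξ y i)

/-- The backward branching-like process: `V_0 = y`, `V_i = F^i_{V_{i−1}+1}`. -/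
def Vproc (ξ : ℤ → ℕ → Bool) (y : ℕ) : ℕ → ℕ
  | 0 => y
  | i + 1 => numFail (ξ ((i : ℤ) + 1)) (Vproc ξ y i + 1)

/-- Row vectors invariant under a stochastic matrix have invariant absolute value. -/
theorem IsStochastic.vecMul_abs {S : Type*} [Fintype S] {K : Matrix S S ℝ} (hK : IsStochastic K)
    {v : S → ℝ} (hv : vecMul v K = v) : vecMul (fun i => |v i|) K = fun i => |v i| := by
  have hle : ∀ j ∈ Finset.univ, |v j| ≤ vecMul (fun i => |v i|) K j := by
    intro j _
    have hj : v j = ∑ i, v i * K i j := by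
      conv_lhs => rw [← hv]
      rfl
    rw [hj]
    refine (Finset.abs_sum_le_sum_abs _ _).trans (le_of_eq ?_)
    simp only [vecMul, dotProduct]
    exact Finset.sum_congr rfl fun i _ => by rw [abs_mul, abs_of_nonneg (hK.1 i j)]
  have hsum : ∑ j, |v j| = ∑ j, vecMul (fun i => |v i|) K j := by
    simp only [vecMul, dotProduct]
    rw [Finset.sum_comm]
    simp [← Finset.mul_sum, hK.2]
  funext j
  exact ((Finset.sum_eq_sum_iff_of_le hle).1 hsum j (Finset.mem_univ j)).symm

theorem HasUniqueStationaryDist.eq_smul_of_nonneg {S : Type*} [Fintype S] {K : Matrix S S ℝ}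
    {μ v : S → ℝ} (hμ : HasUniqueStationaryDist K μ) (hv : vecMul v K = v) (h0 : ∀ i, 0 ≤ v i) :
    ∃ c : ℝ, v = c • μ := by
  by_cases hs : ∑ i, v i = 0
  · refine ⟨0, ?_⟩
    funext i
    simpa using (Finset.sum_eq_zero_iff_of_nonneg fun i _ => h0 i).1 hs i (Finset.mem_univ i)
  · have hstat : IsStationaryDist K ((∑ i, v i)⁻¹ • v) := by
      refine ⟨⟨fun i => ?_, ?_⟩, ?_⟩
      · exact mul_nonneg (inv_nonneg.2 (Finset.sum_nonneg fun i _ => h0 i)) (h0 i)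
      · simp [← Finset.mul_sum, inv_mul_cancel₀ hs]
      · rw [smul_vecMul, hv]
    exact ⟨∑ i, v i, by rw [← hμ.2 _ hstat, smul_smul, mul_inv_cancel₀ hs, one_smul]⟩

theorem HasUniqueStationaryDist.eq_smul {S : Type*} [Fintype S] {K : Matrix S S ℝ}
    (hK : IsStochastic K) {μ v : S → ℝ} (hμ : HasUniqueStationaryDist K μ)
    (hv : vecMul v K = v) : ∃ c : ℝ, v = c • μ := by
  have habs := hK.vecMul_abs hv
  obtain ⟨a, ha⟩ := hμ.eq_smul_of_nonneg (v := (fun i => |v i|) + v)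
    (by rw [add_vecMul, habs, hv])
    (fun i => by have := neg_abs_le (v i); simp only [Pi.add_apply]; linarith)
  obtain ⟨b, hb⟩ := hμ.eq_smul_of_nonneg habs (fun i => abs_nonneg _)
  refine ⟨a - b, ?_⟩
  rw [sub_smul, ← ha, ← hb]
  simp

/-- The Poisson equation of a finite chain with a unique stationary distribution is solvable for
every centred right-hand side. -/
theorem HasUniqueStationaryDist.exists_poisson {S : Type*} [Fintype S] {K : Matrix S S ℝ}
    (hK : IsStochastic K) {μ : S → ℝ} (hμ : HasUniqueStationaryDist K μ) {g : S → ℝ}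
    (hg : ∑ i, μ i * g i = 0) : ∃ h : S → ℝ, ∀ i, h i - ∑ j, K i j * h j = g i := by
  by_contra hne
  have hmem : g ∉ LinearMap.range (Matrix.mulVecLin (1 - K)) := by
    rintro ⟨h, rfl⟩
    refine hne ⟨h, fun i => ?_⟩
    simp [mulVec, dotProduct]
  obtain ⟨f, hf, hker⟩ := Submodule.exists_le_ker_of_notMem hmem
  set v : S → ℝ := fun i => f (Pi.single i 1) with hvdef
  have hfv : ∀ x : S → ℝ, f x = v ⬝ᵥ x := by
    intro x
    rw [LinearMap.pi_apply_eq_sum_univ f x]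
    simp only [dotProduct, smul_eq_mul, hvdef]
    refine Finset.sum_congr rfl fun i _ => ?_
    rw [mul_comm]
    congr 2
    funext j
    simp [Pi.single_apply, eq_comm]
  have hv : vecMul v K = v := by
    have h0 : vecMul v (1 - K) = 0 := by
      refine dotProduct_eq_zero _ fun w => ?_
      rw [← dotProduct_mulVec, ← hfv]
      exact hker ⟨w, rfl⟩
    rw [vecMul_sub, vecMul_one, sub_eq_zero] at h0
    exact h0.symm
  obtain ⟨c, hc⟩ := hμ.eq_smul hK hv
  refine hf ?_
  rw [hfv, hc, smul_dotProduct]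
  simp [dotProduct, hg]

/-- The walk `failures − successes` of a Bernoulli sequence together with the number of successes
still to come, frozen at the `n`-th success. -/
def stoppedWalk (n : ℕ) (b : ℕ → Bool) : ℕ → ℝ × ℕ
  | 0 => (0, n)
  | k + 1 =>
    if (stoppedWalk n b k).2 = 0 then stoppedWalk n b k
    else if b k then ((stoppedWalk n b k).1 - 1, (stoppedWalk n b k).2 - 1)
    else ((stoppedWalk n b k).1 + 1, (stoppedWalk n b k).2)

theorem stoppedWalk_congr (n : ℕ) {b b' : ℕ → Bool} {k : ℕ} (h : ∀ j < k, b j = b' j) :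
    stoppedWalk n b k = stoppedWalk n b' k := by
  induction k with
  | zero => rfl
  | succ k ih =>
    simp only [stoppedWalk, ih fun j hj => h j (hj.trans k.lt_succ_self), h k k.lt_succ_self]

theorem measurable_stoppedWalk {Ω : Type*} [MeasurableSpace Ω] {ξ : ℕ → Ω → Bool}
    (hξ : ∀ j, Measurable (ξ j)) (n k : ℕ) :
    Measurable fun ω => stoppedWalk n (fun j => ξ j ω) k := by
  induction k with
  | zero => exact measurable_const
  | succ k ih =>
    simp only [stoppedWalk]
    have hb : MeasurableSet {ω | ξ k ω = true} := hξ k (measurableSet_singleton true)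
    have h0 : MeasurableSet {ω | (stoppedWalk n (fun j => ξ j ω) k).2 = 0} :=
      ih.snd (measurableSet_singleton 0)
    exact Measurable.ite h0 ih (Measurable.ite hb
      ((ih.fst.sub_const 1).prodMk ((measurable_of_countable fun m : ℕ => m - 1).comp ih.snd))
      ((ih.fst.add_const 1).prodMk ih.snd))

theorem card_filter_range_succ (b : ℕ → Bool) (k : ℕ) :
    ((Finset.range (k + 1)).filter fun j => b j = true).card =
      ((Finset.range k).filter fun j => b j = true).card + if b k then 1 else 0 := by
  rw [Finset.range_add_one, Finset.filter_insert]
  split_ifs <;> simp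

theorem card_filter_range_mono (b : ℕ → Bool) :
    Monotone fun k => ((Finset.range k).filter fun j => b j = true).card :=
  fun _ _ h => Finset.card_le_card (Finset.filter_subset_filter _ (Finset.range_mono h))

/-- The frozen walk either still counts failures minus successes, or equals `numFail b n - n`. -/
theorem stoppedWalk_eq (n : ℕ) (b : ℕ → Bool) (k : ℕ) :
    (((Finset.range k).filter fun j => b j = true).card < n ∧
      stoppedWalk n b k = ((k : ℝ) - 2 * ((Finset.range k).filter fun j => b j = true).card,
        n - ((Finset.range k).filter fun j => b j = true).card)) ∨
    (n ≤ ((Finset.range k).filter fun j => b j = true).card ∧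
      stoppedWalk n b k = ((numFail b n : ℝ) - n, 0)) := by
  induction k with
  | zero =>
    rcases Nat.eq_zero_or_pos n with rfl | hn
    · right
      have : numFail b 0 = 0 := Nat.sInf_eq_zero.2 (Or.inl (by simp))
      simp [stoppedWalk, this]
    · left
      simp [stoppedWalk, hn]
  | succ k ih =>
    have hmono := card_filter_range_mono b
    have hsucc := card_filter_range_succ b k
    set s := ((Finset.range k).filter fun j => b j = true).card with hs
    rcases ih with ⟨hlt, hw⟩ | ⟨hle, hw⟩
    · have hne : n - s ≠ 0 := by omega
      by_cases hb : b k = true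
      · rw [if_pos hb] at hsucc
        rw [hsucc]
        rcases Nat.lt_or_ge (s + 1) n with h1 | h1
        · left
          refine ⟨h1, ?_⟩
          simp only [stoppedWalk, hw, hne, hb, if_true, if_false]
          ext
          · push_cast; ring
          · simp; omega
        · right
          have hsn : s + 1 = n := by omega
          have hsk : s ≤ k := by
            simpa [hs] using Finset.card_filter_le (Finset.range k) fun j => b j = true
          have hF : numFail b n = k + 1 - n := by
            have hadd : k + 1 - n + n = k + 1 := by omega
            refine le_antisymm (Nat.sInf_le ?_) (le_csInf ⟨k + 1 - n, ?_⟩ ?_)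
            · rw [Set.mem_ofPred_eq, hadd, hsucc, hsn]
            · rw [Set.mem_ofPred_eq, hadd, hsucc, hsn]
            · intro j hj
              by_contra hjk
              have h2 : ((Finset.range (j + n)).filter fun j => b j = true).card ≤ s :=
                hmono (show j + n ≤ k by omega)
              rw [Set.mem_ofPred_eq] at hj
              omega
          refine ⟨h1, ?_⟩
          simp only [stoppedWalk, hw, hne, hb, if_true, if_false]
          have hnk : n ≤ k + 1 := by omega
          ext
          · rw [hF, Nat.cast_sub hnk, ← hsn]
            push_cast
            ring
          · simp; omega
      · rw [if_neg hb, add_zero] at hsucc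
        rw [hsucc]
        left
        refine ⟨hlt, ?_⟩
        simp only [stoppedWalk, hw, hne, hb, if_false, Bool.false_eq_true]
        ext
        · push_cast; ring
        · rfl
    · right
      exact ⟨hle.trans (hmono k.le_succ), by simp [stoppedWalk, hw]⟩

theorem pow_four_numFail_sub_le_liminf (n : ℕ) (b : ℕ → Bool) :
    ENNReal.ofReal (((numFail b n : ℝ) - n) ^ 4) ≤
      liminf (fun k => ENNReal.ofReal ((stoppedWalk n b k).1 ^ 4)) atTop := by
  refine le_liminf_of_le (h := ?_)
  by_cases h : ∃ k, n ≤ ((Finset.range k).filter fun j => b j = true).card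
  · obtain ⟨k, hk⟩ := h
    filter_upwards [eventually_ge_atTop k] with j hj
    rcases stoppedWalk_eq n b j with ⟨hlt, -⟩ | ⟨-, hw⟩
    · exact absurd (hk.trans (card_filter_range_mono b hj)) (not_le.2 hlt)
    · rw [hw]
  · push Not at h
    have hF : numFail b n = 0 := Nat.sInf_eq_zero.2 <| Or.inr <|
      Set.eq_empty_of_forall_notMem fun j hj => (h (j + n)).ne hj
    filter_upwards [eventually_ge_atTop (3 * n)] with j hj
    rcases stoppedWalk_eq n b j with ⟨hlt, hw⟩ | ⟨hle, -⟩
    · rw [hw, hF]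
      refine ENNReal.ofReal_le_ofReal ?_
      have h1 : ((((Finset.range j).filter fun j => b j = true).card : ℕ) : ℝ) ≤ n := by
        exact_mod_cast hlt.le
      have h2 : (3 : ℝ) * n ≤ j := by exact_mod_cast hj
      calc (((0 : ℕ) : ℝ) - n) ^ 4 = (n : ℝ) ^ 4 := by push_cast; ring
        _ ≤ _ := pow_le_pow_left₀ n.cast_nonneg (by dsimp only; linarith) 4
    · exact absurd (h j) (not_lt.2 hle)

/-- One-step estimate for the quartic potential, for a single value of the increment. -/
theorem quartic_potential_step {M D B α β m c : ℝ} (hD : |D| ≤ B) (hα : 0 ≤ α) (hβ : 0 ≤ β)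
    (hm : 1 ≤ m) (hc : c = 0 ∨ c = 1) :
    (M + D) ^ 4 + α * (m - c) * (M + D) ^ 2 + β * (m - c) ^ 2 ≤
      (M ^ 4 + α * m * M ^ 2 + β * m ^ 2 + 8 * B ^ 2 * M ^ 2 + 3 * B ^ 4 + α * m * B ^ 2
        + α * B ^ 2) + (4 * M ^ 3 + 2 * α * m * M) * D - c * (α * M ^ 2 / 2 + β * m) := by
  have hD2 : D ^ 2 ≤ B ^ 2 := sq_le_sq' (neg_le_of_abs_le hD) (le_of_abs_le hD)
  have hD4 : D ^ 4 ≤ B ^ 4 := by nlinarith [sq_nonneg D, sq_nonneg B]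
  have h4 : (M + D) ^ 4 ≤ M ^ 4 + 4 * M ^ 3 * D + 8 * B ^ 2 * M ^ 2 + 3 * B ^ 4 := by
    nlinarith [mul_nonneg (sq_nonneg D) (sq_nonneg (M - D)),
      mul_le_mul_of_nonneg_right hD2 (sq_nonneg M)]
  have h2 : α * (m - c) * (M + D) ^ 2 ≤ α * m * M ^ 2 + 2 * α * m * M * D + α * m * B ^ 2
      + α * B ^ 2 - c * (α * M ^ 2 / 2) := by
    have hαm : 0 ≤ α * m := mul_nonneg hα (zero_le_one.trans hm)
    have e1 := mul_le_mul_of_nonneg_left hD2 hαm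
    have e2 := mul_le_mul_of_nonneg_left hD2 hα
    rcases hc with rfl | rfl
    · nlinarith [mul_nonneg hα (sq_nonneg B)]
    · nlinarith [mul_nonneg hα (sq_nonneg (M + 2 * D))]
  have h1 : β * (m - c) ^ 2 ≤ β * m ^ 2 - c * (β * m) := by
    rcases hc with rfl | rfl
    · simp
    · nlinarith [mul_le_mul_of_nonneg_left hm hβ]
  linarith

/-- The potential controlling the fourth power of the walk at the `n`-th success: `r` is the
state of the chain and `y` the pair (walk, successes to come). -/
def quarticPotential {S : Type*} (h : S → ℝ) (H α β : ℝ) (r : S) (y : ℝ × ℕ) : ℝ :=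
  if y.2 = 0 then y.1 ^ 4 / 8
  else (y.1 + h r) ^ 4 + α * y.2 * (y.1 + h r) ^ 2 + β * y.2 ^ 2 + H ^ 4

theorem pow_four_div_le {x a H : ℝ} (ha : |a| ≤ H) : x ^ 4 / 8 ≤ (x + a) ^ 4 + H ^ 4 := by
  have h1 : a ^ 4 ≤ H ^ 4 := by
    rw [← Even.pow_abs (by decide : Even 4) a]
    exact pow_le_pow_left₀ (abs_nonneg a) ha 4
  have h2 : x ^ 2 / 2 ≤ (x + a) ^ 2 + a ^ 2 := by nlinarith [sq_nonneg (x + 2 * a)]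
  nlinarith [mul_self_le_mul_self (by positivity) h2, sq_nonneg ((x + a) ^ 2 - a ^ 2)]

theorem quarticPotential_le {S : Type*} {h : S → ℝ} {H α β : ℝ} (hH : ∀ r, |h r| ≤ H)
    (r : S) (x : ℝ) (m : ℕ) :
    quarticPotential h H α β r (x, m) ≤
      (x + h r) ^ 4 + α * m * (x + h r) ^ 2 + β * m ^ 2 + H ^ 4 := by
  rw [quarticPotential]
  split_ifs with hm
  · have hm' : m = 0 := hm
    subst hm'
    simpa using pow_four_div_le (hH r)
  · rfl

theorem le_quarticPotential {S : Type*} {h : S → ℝ} {H α β : ℝ} (hH : ∀ r, |h r| ≤ H)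
    (hα : 0 ≤ α) (hβ : 0 ≤ β) (r : S) (y : ℝ × ℕ) :
    y.1 ^ 4 / 8 ≤ quarticPotential h H α β r y := by
  rw [quarticPotential]
  split_ifs
  · rfl
  · have := pow_four_div_le (x := y.1) (hH r)
    have h1 : 0 ≤ α * y.2 * (y.1 + h r) ^ 2 := by positivity
    have h2 : 0 ≤ β * (y.2 : ℝ) ^ 2 := by positivity
    linarith

/-- Averaging over one step of the chain and the coin. -/
theorem sum_bernoulli_step_le {S : Type*} [Fintype S] {K : Matrix S S ℝ} (hK : IsStochastic K)
    {h : S → ℝ} {r : S} {q a e d : ℝ} (hq : q ∈ Set.Ioo (0 : ℝ) 1)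
    (hh : h r - ∑ s, K r s * h s = 1 - 2 * q) {X₁ X₀ : S → ℝ}
    (h₁ : ∀ s, X₁ s ≤ a + e * (h s - h r - 1) - d) (h₀ : ∀ s, X₀ s ≤ a + e * (h s - h r + 1)) :
    ∑ s, K r s * (q * X₁ s + (1 - q) * X₀ s) ≤ a - q * d := by
  have hq1 : 0 ≤ 1 - q := by linarith [hq.2]
  calc ∑ s, K r s * (q * X₁ s + (1 - q) * X₀ s)
      ≤ ∑ s, K r s * (q * (a + e * (h s - h r - 1) - d) + (1 - q) * (a + e * (h s - h r + 1))) :=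
        Finset.sum_le_sum fun s _ => mul_le_mul_of_nonneg_left
          (add_le_add (mul_le_mul_of_nonneg_left (h₁ s) hq.1.le)
            (mul_le_mul_of_nonneg_left (h₀ s) hq1)) (hK.1 r s)
    _ = ∑ s, (K r s * (a - q * d + e * (1 - 2 * q) - e * h r) + e * (K r s * h s)) :=
        Finset.sum_congr rfl fun s _ => by ring
    _ = a - q * d := by
        rw [Finset.sum_add_distrib, ← Finset.sum_mul, ← Finset.mul_sum, hK.2 r,
          show ∑ s, K r s * h s = h r - (1 - 2 * q) by linarith]
        ring

theorem quarticPotential_superharmonic {S : Type*} [Fintype S] {K : Matrix S S ℝ}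
    (hK : IsStochastic K) {h p : S → ℝ} (hp : ∀ i, p i ∈ Set.Ioo (0 : ℝ) 1)
    (hh : ∀ r, h r - ∑ s, K r s * h s = 1 - 2 * p r) {H δ α β : ℝ} (hH : ∀ r, |h r| ≤ H)
    (hδ : 0 < δ) (hδp : ∀ r, δ ≤ p r)
    (hα : α = 16 * (2 * H + 1) ^ 2 / δ)
    (hβ : β = (3 * (2 * H + 1) ^ 4 + 2 * α * (2 * H + 1) ^ 2) / δ)
    (r : S) (x : ℝ) {m : ℕ} (hm : m ≠ 0) :
    ∑ s, K r s * (p r * quarticPotential h H α β s (x - 1, m - 1)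
      + (1 - p r) * quarticPotential h H α β s (x + 1, m)) ≤ quarticPotential h H α β r (x, m) := by
  set B := 2 * H + 1 with hB
  have hα0 : 0 ≤ α := hα ▸ by positivity
  have hβ0 : 0 ≤ β := hβ ▸ by positivity
  have hm1 : (1 : ℝ) ≤ m := by exact_mod_cast Nat.one_le_iff_ne_zero.2 hm
  have hdiff : ∀ s, -(2 * H) ≤ h s - h r ∧ h s - h r ≤ 2 * H := fun s => by
    have h1 := abs_le.1 (hH s)
    have h2 := abs_le.1 (hH r)
    constructor <;> linarith [h1.1, h1.2, h2.1, h2.2]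
  set M := x + h r with hM
  refine (sum_bernoulli_step_le hK (hp r) (hh r)
    (a := M ^ 4 + α * m * M ^ 2 + β * m ^ 2 + 8 * B ^ 2 * M ^ 2 + 3 * B ^ 4 + α * m * B ^ 2
        + α * B ^ 2 + H ^ 4) (e := 4 * M ^ 3 + 2 * α * m * M) (d := α * M ^ 2 / 2 + β * m)
    (fun s => ?_) (fun s => ?_)).trans ?_
  · refine (quarticPotential_le hH s _ _).trans ?_
    have := quartic_potential_step (M := M) (D := h s - h r - 1) (B := B) (m := m) (c := 1)
      (abs_le.2 ⟨by linarith [(hdiff s).1], by linarith [(hdiff s).2]⟩) hα0 hβ0 hm1 (Or.inr rfl)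
    rw [Nat.cast_pred (Nat.pos_of_ne_zero hm),
      show x - 1 + h s = M + (h s - h r - 1) by rw [hM]; ring]
    linarith
  · refine (quarticPotential_le hH s _ _).trans ?_
    have := quartic_potential_step (M := M) (D := h s - h r + 1) (B := B) (m := m) (c := 0)
      (abs_le.2 ⟨by linarith [(hdiff s).1], by linarith [(hdiff s).2]⟩) hα0 hβ0 hm1 (Or.inl rfl)
    rw [show x + 1 + h s = M + (h s - h r + 1) by rw [hM]; ring]
    linarith
  · rw [quarticPotential, if_neg (by simpa using hm)]
    have hαδ : α * δ = 16 * B ^ 2 := by rw [hα]; field_simp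
    have hβδ : β * δ = 3 * B ^ 4 + 2 * α * B ^ 2 := by rw [hβ]; field_simp
    have hd : 0 ≤ α * M ^ 2 / 2 + β * m := by positivity
    have h1 := mul_le_mul_of_nonneg_right (hδp r) hd
    have h2 : δ * (α * M ^ 2 / 2 + β * m)
        = 8 * B ^ 2 * M ^ 2 + (3 * B ^ 4 + 2 * α * B ^ 2) * m := by
      linear_combination (M ^ 2 / 2) * hαδ + (m : ℝ) * hβδ
    have h3 : 0 ≤ (3 * B ^ 4 + α * B ^ 2) * ((m : ℝ) - 1) :=
      mul_nonneg (by positivity) (by linarith)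
    dsimp only
    linarith

/-- The event that the environment agrees with `f` up to time `k` and the coin tosses agree with
`b` before time `k`. -/
def siteCylinder {S Ω : Type*} (Rc : ℕ → Ω → S) (ξ : ℕ → Ω → Bool) (k : ℕ) (f : ℕ → S)
    (b : ℕ → Bool) : Set Ω :=
  {ω | (∀ j ≤ k, Rc j ω = f j) ∧ ∀ j < k, ξ j ω = b j}

/-- The probability of `siteCylinder`. -/
def siteWeight {S : Type*} (K : Matrix S S ℝ) (p η : S → ℝ) (k : ℕ) (f : ℕ → S)
    (b : ℕ → Bool) : ℝ :=
  η (f 0) * ∏ j ∈ Finset.range k, (K (f j) (f (j + 1)) * if b j then p (f j) else 1 - p (f j))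

theorem siteWeight_nonneg {S : Type*} [Fintype S] {K : Matrix S S ℝ} (hK : IsStochastic K)
    {p η : S → ℝ} (hp : ∀ i, p i ∈ Set.Ioo (0 : ℝ) 1) (hη : IsProbVec η) (k : ℕ) (f : ℕ → S)
    (b : ℕ → Bool) : 0 ≤ siteWeight K p η k f b := by
  refine mul_nonneg (hη.1 _) (Finset.prod_nonneg fun j _ => mul_nonneg (hK.1 _ _) ?_)
  split_ifs
  · exact (hp _).1.le
  · linarith [(hp (f j)).2]

theorem siteWeight_update {S : Type*} (K : Matrix S S ℝ) (p η : S → ℝ) (k : ℕ) (f : ℕ → S)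
    (b : ℕ → Bool) (s : S) (c : Bool) :
    siteWeight K p η (k + 1) (Function.update f (k + 1) s) (Function.update b k c) =
      siteWeight K p η k f b * (K (f k) s * if c then p (f k) else 1 - p (f k)) := by
  have hf : ∀ j, j ≤ k → Function.update f (k + 1) s j = f j := fun j hj =>
    Function.update_of_ne (by omega) _ _
  rw [siteWeight, siteWeight, Finset.prod_range_succ, hf 0 k.zero_le, hf k le_rfl,
    Function.update_self, Function.update_self, mul_assoc]
  congr 2
  refine Finset.prod_congr rfl fun j hj => ?_
  have hj' := Finset.mem_range.1 hj
  rw [hf j hj'.le, hf (j + 1) hj', Function.update_of_ne hj'.ne]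

theorem measurableSet_siteCylinder {N : ℕ} {Ω : Type*} [MeasurableSpace Ω] {Rc : ℕ → Ω → Fin N}
    {ξ : ℕ → Ω → Bool} (hR : ∀ j, Measurable (Rc j)) (hξ : ∀ j, Measurable (ξ j)) (k : ℕ)
    (f : ℕ → Fin N) (b : ℕ → Bool) : MeasurableSet (siteCylinder Rc ξ k f b) := by
  have heq : siteCylinder Rc ξ k f b =
      (⋂ j, ⋂ _ : j ≤ k, Rc j ⁻¹' {f j}) ∩ ⋂ j, ⋂ _ : j < k, ξ j ⁻¹' {b j} := by
    ext ω
    simp [siteCylinder]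
  rw [heq]
  exact (MeasurableSet.iInter fun j => MeasurableSet.iInter fun _ =>
    hR j (measurableSet_singleton (f j))).inter
    (MeasurableSet.iInter fun j => MeasurableSet.iInter fun _ =>
      hξ j (measurableSet_singleton (b j)))

theorem siteCylinder_subset {S Ω : Type*} (Rc : ℕ → Ω → S) (ξ : ℕ → Ω → Bool) (k : ℕ)
    (f : ℕ → S) (b : ℕ → Bool) :
    siteCylinder Rc ξ k f b ⊆ ⋃ sc : S × Bool,
      siteCylinder Rc ξ (k + 1) (Function.update f (k + 1) sc.1) (Function.update b k sc.2) := by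
  rintro ω ⟨hf, hb⟩
  refine Set.mem_iUnion.2 ⟨(Rc (k + 1) ω, ξ k ω), fun j hj => ?_, fun j hj => ?_⟩
  · rcases eq_or_ne j (k + 1) with rfl | hne
    · simp
    · rw [Function.update_of_ne hne]
      exact hf j (by omega)
  · rcases eq_or_ne j k with rfl | hne
    · simp
    · rw [Function.update_of_ne hne]
      exact hb j (by omega)

theorem IsCookieSite.measure_siteCylinder_le {N : ℕ} {Ω : Type*} [MeasurableSpace Ω]
    {P : Measure Ω} [IsFiniteMeasure P] {K : Matrix (Fin N) (Fin N) ℝ} {p η : Fin N → ℝ}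
    {Rc : ℕ → Ω → Fin N} {ξ : ℕ → Ω → Bool} (hP : IsCookieSite P K p η Rc ξ) (k : ℕ)
    (f : ℕ → Fin N) (b : ℕ → Bool) :
    P (siteCylinder Rc ξ k f b) ≤ ENNReal.ofReal (siteWeight K p η k f b) := by
  have hsub : siteCylinder Rc ξ k f b ⊆
      ⋃ c : Bool, {ω | ∀ j ≤ k, Rc j ω = f j ∧ ξ j ω = Function.update b k c j} := by
    rintro ω ⟨hf, hb⟩
    refine Set.mem_iUnion.2 ⟨ξ k ω, fun j hj => ⟨hf j hj, ?_⟩⟩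
    rcases eq_or_ne j k with rfl | hne
    · simp
    · rw [Function.update_of_ne hne]
      exact hb j (by omega)
  have hreal : ∀ c : Bool,
      (P {ω | ∀ j ≤ k, Rc j ω = f j ∧ ξ j ω = Function.update b k c j}).toReal =
        siteWeight K p η k f b * if c then p (f k) else 1 - p (f k) := by
    intro c
    rw [hP.2.2 k f (Function.update b k c), siteWeight, Finset.prod_range_succ,
      Function.update_self, Finset.prod_mul_distrib, ← mul_assoc, ← mul_assoc]
    congr 2
    refine Finset.prod_congr rfl fun j hj => ?_
    rw [Function.update_of_ne (Finset.mem_range.1 hj).ne]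
  refine (measure_mono hsub).trans ((measure_iUnion_fintype_le _ _).trans (le_of_eq ?_))
  rw [← ENNReal.ofReal_toReal (ENNReal.sum_ne_top.2 fun c _ => measure_ne_top P _),
    ENNReal.toReal_sum fun c _ => measure_ne_top P _]
  congr 1
  simp only [hreal, Fintype.sum_bool, if_true, Bool.false_eq_true, if_false]
  ring

/-- A function superharmonic for the environment together with the frozen walk dominates the
expected fourth moment of the frozen walk at any later time. -/
theorem IsCookieSite.lintegral_siteCylinder_le {N : ℕ} {Ω : Type*} [MeasurableSpace Ω]
    {P : Measure Ω} [IsFiniteMeasure P] {K : Matrix (Fin N) (Fin N) ℝ} {p η : Fin N → ℝ}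
    {Rc : ℕ → Ω → Fin N} {ξ : ℕ → Ω → Bool} (hP : IsCookieSite P K p η Rc ξ)
    (hK : IsStochastic K) (hp : ∀ i, p i ∈ Set.Ioo (0 : ℝ) 1) (hη : IsProbVec η)
    {Ψ : Fin N → ℝ × ℕ → ℝ} (hΨ : ∀ r y, y.1 ^ 4 / 8 ≤ Ψ r y)
    (hconst : ∀ r s x, Ψ r (x, 0) = Ψ s (x, 0))
    (hsuper : ∀ r x m, m ≠ 0 →
      ∑ s, K r s * (p r * Ψ s (x - 1, m - 1) + (1 - p r) * Ψ s (x + 1, m)) ≤ Ψ r (x, m))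
    (n L : ℕ) : ∀ (k : ℕ) (f : ℕ → Fin N) (b : ℕ → Bool),
    ∫⁻ ω in siteCylinder Rc ξ k f b,
        ENNReal.ofReal ((stoppedWalk n (fun j => ξ j ω) (k + L)).1 ^ 4 / 8) ∂P ≤
      ENNReal.ofReal (siteWeight K p η k f b * Ψ (f k) (stoppedWalk n b k)) := by
  have hΨ0 : ∀ r y, 0 ≤ Ψ r y := fun r y => le_trans (by positivity) (hΨ r y)
  induction L with
  | zero =>
    intro k f b
    calc _ ≤ ∫⁻ _ in siteCylinder Rc ξ k f b, ENNReal.ofReal (Ψ (f k) (stoppedWalk n b k)) ∂P := by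
          refine setLIntegral_mono' (measurableSet_siteCylinder hP.1 hP.2.1 k f b) fun ω hω => ?_
          rw [add_zero, stoppedWalk_congr n hω.2]
          exact ENNReal.ofReal_le_ofReal (hΨ _ _)
      _ ≤ _ := by
          rw [setLIntegral_const, mul_comm, ENNReal.ofReal_mul (siteWeight_nonneg hK hp hη k f b)]
          gcongr
          exact hP.measure_siteCylinder_le k f b
  | succ L ih =>
    intro k f b
    refine (lintegral_mono_set (siteCylinder_subset Rc ξ k f b)).trans
      ((lintegral_iUnion_le _ _).trans ?_)
    rw [tsum_fintype]
    have hstep : ∀ sc : Fin N × Bool, _ := fun sc =>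
      ih (k + 1) (Function.update f (k + 1) sc.1) (Function.update b k sc.2)
    simp only [show ∀ L', k + 1 + L' = k + (L' + 1) by intro; omega] at hstep
    refine (Finset.sum_le_sum fun sc _ => hstep sc).trans ?_
    rw [← ENNReal.ofReal_sum_of_nonneg fun sc _ =>
      mul_nonneg (siteWeight_nonneg hK hp hη _ _ _) (hΨ0 _ _)]
    refine ENNReal.ofReal_le_ofReal ?_
    simp only [siteWeight_update, Function.update_self, mul_assoc]
    rw [← Finset.mul_sum]
    refine mul_le_mul_of_nonneg_left ?_ (siteWeight_nonneg hK hp hη k f b)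
    rw [Fintype.sum_prod_type]
    have hw : ∀ c : Bool, stoppedWalk n (Function.update b k c) k = stoppedWalk n b k := fun c =>
      stoppedWalk_congr n fun j hj => Function.update_of_ne hj.ne _ _
    rcases hy : stoppedWalk n b k with ⟨x, m⟩
    rcases eq_or_ne m 0 with rfl | hm
    · simp only [stoppedWalk, hw, hy, if_true, Fintype.sum_bool, Bool.false_eq_true, if_false]
      rw [Finset.sum_congr rfl fun s _ => show
        K (f k) s * (p (f k) * Ψ s (x, 0)) + K (f k) s * ((1 - p (f k)) * Ψ s (x, 0))
          = K (f k) s * Ψ (f k) (x, 0) by rw [hconst s (f k)]; ring,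
        ← Finset.sum_mul, hK.2, one_mul]
    · refine le_trans (le_of_eq (Finset.sum_congr rfl fun s _ => ?_)) (hsuper (f k) x m hm)
      simp only [stoppedWalk, hw, hy, hm, Function.update_self, if_true, Fintype.sum_bool,
        Bool.false_eq_true, if_false]
      ring

theorem IsCookieSite.lintegral_stoppedWalk_le {N : ℕ} {Ω : Type*} [MeasurableSpace Ω]
    {P : Measure Ω} [IsFiniteMeasure P] {K : Matrix (Fin N) (Fin N) ℝ} {p η : Fin N → ℝ}
    {Rc : ℕ → Ω → Fin N} {ξ : ℕ → Ω → Bool} (hP : IsCookieSite P K p η Rc ξ)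
    (hK : IsStochastic K) (hp : ∀ i, p i ∈ Set.Ioo (0 : ℝ) 1) (hη : IsProbVec η)
    {Ψ : Fin N → ℝ × ℕ → ℝ} (hΨ : ∀ r y, y.1 ^ 4 / 8 ≤ Ψ r y)
    (hconst : ∀ r s x, Ψ r (x, 0) = Ψ s (x, 0))
    (hsuper : ∀ r x m, m ≠ 0 →
      ∑ s, K r s * (p r * Ψ s (x - 1, m - 1) + (1 - p r) * Ψ s (x + 1, m)) ≤ Ψ r (x, m))
    {n : ℕ} {C : ℝ} (hC : ∀ r, Ψ r (0, n) ≤ C) (L : ℕ) :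
    ∫⁻ ω, ENNReal.ofReal ((stoppedWalk n (fun j => ξ j ω) L).1 ^ 4) ∂P ≤
      ENNReal.ofReal (8 * C) := by
  have huniv : (Set.univ : Set Ω) ⊆
      ⋃ r : Fin N, siteCylinder Rc ξ 0 (fun _ => r) (fun _ => false) := fun ω _ =>
    Set.mem_iUnion.2 ⟨Rc 0 ω, fun j hj => by rw [Nat.le_zero.1 hj], fun j hj => by omega⟩
  have hΨ0 : ∀ r y, 0 ≤ Ψ r y := fun r y => le_trans (by positivity) (hΨ r y)
  have key : ∫⁻ ω, ENNReal.ofReal ((stoppedWalk n (fun j => ξ j ω) L).1 ^ 4 / 8) ∂P ≤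
      ENNReal.ofReal C := by
    rw [← setLIntegral_univ]
    refine (lintegral_mono_set huniv).trans ((lintegral_iUnion_le _ _).trans ?_)
    rw [tsum_fintype]
    have hr := fun r : Fin N => hP.lintegral_siteCylinder_le hK hp hη hΨ hconst hsuper n L 0
      (fun _ => r) (fun _ => false)
    simp only [zero_add] at hr
    refine (Finset.sum_le_sum fun r _ => hr r).trans ?_
    rw [← ENNReal.ofReal_sum_of_nonneg fun r _ =>
      mul_nonneg (siteWeight_nonneg hK hp hη _ _ _) (hΨ0 _ _)]
    refine ENNReal.ofReal_le_ofReal ?_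
    simp only [siteWeight, Finset.range_zero, Finset.prod_empty, mul_one, stoppedWalk]
    calc ∑ r, η r * Ψ r (0, n) ≤ ∑ r, η r * C :=
          Finset.sum_le_sum fun r _ => mul_le_mul_of_nonneg_left (hC r) (hη.1 r)
      _ = C := by rw [← Finset.sum_mul, hη.2, one_mul]
  have h8 : ∀ x : ℝ, ENNReal.ofReal (x ^ 4) = ENNReal.ofReal 8 * ENNReal.ofReal (x ^ 4 / 8) :=
    fun x => by rw [← ENNReal.ofReal_mul (by norm_num)]; congr 1; ring
  simp only [h8]
  rw [lintegral_const_mul' _ _ ENNReal.ofReal_ne_top, ENNReal.ofReal_mul (by norm_num)]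
  gcongr

theorem sum_numFail_increments (b : ℕ → Bool) (n : ℕ) :
    ∑ j ∈ Finset.range n, ((numFail b (j + 1) : ℝ) - (numFail b j : ℝ) - 1) =
      (numFail b n : ℝ) - n := by
  have h0 : numFail b 0 = 0 := Nat.sInf_eq_zero.2 (Or.inl (by simp))
  rw [Finset.sum_sub_distrib, Finset.sum_range_sub fun j => (numFail b j : ℝ), h0]
  simp

/-- **Lemma A.2 (fourth moment bound, critical case `p̄ = 1/2`).** There is a constant
`A > 0` such that for every initial distribution `η` and all `n ≥ 1`,
`E_η[(Σ_{i=1}^n (G̃_i − 1))⁴] ≤ A n²`, where `G̃_j = F_j − F_{j−1}` is the number of failures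
between the `(j−1)`-st and the `j`-th success of the Bernoulli sequence at a site. -/
theorem failure_increment_sum_fourth_moment
    {N : ℕ} {Ω : Type*} [MeasurableSpace Ω]
    (K : Matrix (Fin N) (Fin N) ℝ) (μ p : Fin N → ℝ)
    (Rc : ℕ → Ω → Fin N) (ξ : ℕ → Ω → Bool)
    (Pfam : (Fin N → ℝ) → Measure Ω)
    (hK : IsStochastic K) (hμ : HasUniqueStationaryDist K μ)
    (hp : ∀ i, p i ∈ Set.Ioo (0 : ℝ) 1)
    (hcrit : ∑ i, μ i * p i = 1 / 2)
    (henv : ∀ η : Fin N → ℝ, IsProbVec η →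
      IsProbabilityMeasure (Pfam η) ∧ IsCookieSite (Pfam η) K p η Rc ξ) :
    ∃ A : ℝ, 0 < A ∧
      ∀ (η : Fin N → ℝ), IsProbVec η → ∀ n : ℕ, 1 ≤ n →
        (∫ ω,
            (∑ j ∈ Finset.range n,
              ((numFail (fun k => ξ k ω) (j + 1) : ℝ) - (numFail (fun k => ξ k ω) j : ℝ) -
                1)) ^ 4 ∂Pfam η) ≤ A * n ^ 2 := by
  have hne : Nonempty (Fin N) := by
    by_contra h
    rw [not_nonempty_iff] at h
    simp at hcrit
  obtain ⟨h, hh⟩ := hμ.exists_poisson hK (g := fun i => 1 - 2 * p i) (by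
    calc ∑ i, μ i * (1 - 2 * p i) = ∑ i, μ i - 2 * ∑ i, μ i * p i := by
          rw [Finset.mul_sum, ← Finset.sum_sub_distrib]
          exact Finset.sum_congr rfl fun i _ => by ring
      _ = 0 := by rw [hμ.1.1.2, hcrit]; norm_num)
  obtain ⟨i₀, hi₀⟩ := Finite.exists_min p
  obtain ⟨i₁, hi₁⟩ := Finite.exists_max fun i => |h i|
  set H := |h i₁| with hHdef
  have hH0 : 0 ≤ H := abs_nonneg _
  set α := 16 * (2 * H + 1) ^ 2 / p i₀ with hα
  set β := (3 * (2 * H + 1) ^ 4 + 2 * α * (2 * H + 1) ^ 2) / p i₀ with hβ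
  have hδ : 0 < p i₀ := (hp i₀).1
  have hα0 : 0 ≤ α := by positivity
  have hβ0 : 0 ≤ β := by positivity
  set C := 2 * H ^ 4 + α * H ^ 2 + β with hC
  have hC0 : 0 ≤ C := by positivity
  refine ⟨8 * C + 1, by positivity, fun η hη n hn => ?_⟩
  obtain ⟨hprob, hP⟩ := henv η hη
  have hn1 : (1 : ℝ) ≤ n := by exact_mod_cast hn
  have hinit : ∀ r, quarticPotential h H α β r (0, n) ≤ C * n ^ 2 := by
    intro r
    refine (quarticPotential_le hi₁ r 0 n).trans ?_
    have h2 : h r ^ 2 ≤ H ^ 2 := sq_le_sq' (neg_le_of_abs_le (hi₁ r)) (le_of_abs_le (hi₁ r))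
    have h4 : h r ^ 4 ≤ H ^ 4 := by nlinarith [sq_nonneg (h r), sq_nonneg H]
    have hnn : (n : ℝ) ≤ n ^ 2 := by nlinarith
    have hn2 : (1 : ℝ) ≤ n ^ 2 := hn1.trans hnn
    calc (0 + h r) ^ 4 + α * n * (0 + h r) ^ 2 + β * n ^ 2 + H ^ 4
        ≤ H ^ 4 * n ^ 2 + α * n ^ 2 * H ^ 2 + β * n ^ 2 + H ^ 4 * n ^ 2 := by
          rw [zero_add]
          gcongr
          · exact h4.trans (le_mul_of_one_le_right (by positivity) hn2)
          · exact le_mul_of_one_le_right (by positivity) hn2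
      _ = C * n ^ 2 := by rw [hC]; ring
  have hbound := hP.lintegral_stoppedWalk_le hK hp hη
    (Ψ := quarticPotential h H α β) (le_quarticPotential hi₁ hα0 hβ0)
    (fun r s x => by simp [quarticPotential])
    (fun r x m hm => quarticPotential_superharmonic hK hp hh hi₁ hδ hi₀ hα hβ r x hm) hinit
  have hfatou : ∫⁻ ω, ENNReal.ofReal (((numFail (fun k => ξ k ω) n : ℝ) - n) ^ 4) ∂Pfam η ≤
      ENNReal.ofReal (8 * (C * n ^ 2)) := by
    refine (lintegral_mono fun ω => pow_four_numFail_sub_le_liminf n fun k => ξ k ω).trans ?_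
    refine (lintegral_liminf_le fun k =>
      ((measurable_stoppedWalk hP.2.1 n k).fst.pow_const 4).ennreal_ofReal).trans ?_
    exact liminf_le_of_frequently_le' (Eventually.of_forall hbound).frequently
  simp only [sum_numFail_increments]
  have hfinal : 8 * (C * (n : ℝ) ^ 2) ≤ (8 * C + 1) * n ^ 2 := by nlinarith
  by_cases hint : Integrable (fun ω => ((numFail (fun k => ξ k ω) n : ℝ) - n) ^ 4) (Pfam η)
  · rw [← ofReal_integral_eq_lintegral_ofReal hint (ae_of_all _ fun ω => by
      simp only [Pi.zero_apply]; positivity)] at hfatou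
    exact ((ENNReal.ofReal_le_ofReal_iff (by positivity)).1 hfatou).trans hfinal
  · rw [integral_undef hint]
    positivity

end
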